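/- arXiv:2510.21989 — 2 statements merged into one kernel-verified Lean document; each statement's English description precedes it below -/
import Mathlib

section
/- Let m > 0 be a real number and let (i,j) and (i',j') be distinct pairs of real numbers with i < j, i' < j', i ≠ i', j ≠ j', and suppose the pairs do not cross, i.e., neither i < i' < j < j' nor i' < i < j' < j holds. Then Δ_m(i,j) ∩ Δ_m(i',j') = {(p,0) : p ∈ {i,j} ∩ {i',j'}}. In particular the two paths are disjoint unless the terminal point of one arc equals the initial point of the other, in which case they meet exactly at that single common boundary point on the x-axis. -/
/-- The apex of the triangular drawing of the arc `(i,j)` with slopes `±m`. -/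
noncomputable def apexPt (m i j : ℝ) : ℝ × ℝ := ((i + j) / 2, m * (j - i) / 2)

/-- The ascending segment of the triangular arc path: from `(i,0)` to the apex. -/
noncomputable def ascSeg (m i j : ℝ) : Set (ℝ × ℝ) :=
  segment ℝ ((i, 0) : ℝ × ℝ) (apexPt m i j)

/-- The descending segment of the triangular arc path: from the apex to `(j,0)`. -/
noncomputable def descSeg (m i j : ℝ) : Set (ℝ × ℝ) :=
  segment ℝ (apexPt m i j) ((j, 0) : ℝ × ℝ)

/-- The triangular drawing `Δ_m(i,j)` of the arc `(i,j)`. -/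
noncomputable def triPath (m i j : ℝ) : Set (ℝ × ℝ) := ascSeg m i j ∪ descSeg m i j

lemma mem_triPath_iff_aux (m i j x y : ℝ) (hij : i < j) :
    (x, y) ∈ triPath m i j ↔
      (y = m * (x - i) ∧ i ≤ x ∧ x ≤ (i + j) / 2) ∨
      (y = m * (j - x) ∧ (i + j) / 2 ≤ x ∧ x ≤ j) := by
  have hd : 0 < j - i := sub_pos.2 hij
  have hd' : j - i ≠ 0 := hd.ne'
  simp only [triPath, ascSeg, descSeg, apexPt, Set.mem_union, segment, Set.mem_ofPred_eq,
    Prod.smul_mk, Prod.mk_add_mk, Prod.mk.injEq, smul_eq_mul]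
  refine or_congr ⟨?_, ?_⟩ ⟨?_, ?_⟩
  · rintro ⟨a, b, ha, hb, hab, rfl, rfl⟩
    obtain rfl : a = 1 - b := by linarith
    refine ⟨by ring, by nlinarith, by nlinarith⟩
  · rintro ⟨rfl, h1, h2⟩
    refine ⟨1 - 2 * (x - i) / (j - i), 2 * (x - i) / (j - i), ?_, ?_, by ring, ?_, ?_⟩
    · rw [sub_nonneg, div_le_one hd]; linarith
    · exact div_nonneg (by linarith) hd.le
    · field_simp; ring
    · field_simp; ring
  · rintro ⟨a, b, ha, hb, hab, rfl, rfl⟩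
    obtain rfl : b = 1 - a := by linarith
    refine ⟨by ring, by nlinarith, by nlinarith⟩
  · rintro ⟨rfl, h1, h2⟩
    refine ⟨2 * (j - x) / (j - i), 1 - 2 * (j - x) / (j - i), ?_, ?_, by ring, ?_, ?_⟩
    · exact div_nonneg (by linarith) hd.le
    · rw [sub_nonneg, div_le_one hd]; linarith
    · field_simp; ring
    · field_simp; ring

/-- For noncrossing distinct arcs `(i,j)` and `(i',j')` with distinct initial points and
distinct terminal points, the triangular arc paths meet exactly in the common boundary
points on the x-axis: `Δ_m(i,j) ∩ Δ_m(i',j') = {(p,0) : p ∈ {i,j} ∩ {i',j'}}`. -/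
theorem stmt11 (m i j i' j' : ℝ) (hm : 0 < m) (hij : i < j) (hij' : i' < j')
    (hne : (i, j) ≠ (i', j')) (hi : i ≠ i') (hj : j ≠ j')
    (hnc1 : ¬(i < i' ∧ i' < j ∧ j < j')) (hnc2 : ¬(i' < i ∧ i < j' ∧ j' < j)) :
    triPath m i j ∩ triPath m i' j' =
      (fun q : ℝ => ((q, 0) : ℝ × ℝ)) '' (({i, j} : Set ℝ) ∩ ({i', j'} : Set ℝ)) := by
  ext ⟨x, y⟩
  simp only [Set.mem_inter_iff, mem_triPath_iff_aux m i j x y hij,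
    mem_triPath_iff_aux m i' j' x y hij', Set.mem_image, Set.mem_insert_iff,
    Set.mem_singleton_iff, Prod.mk.injEq]
  constructor
  · rintro ⟨⟨h1, h2, h3⟩ | ⟨h1, h2, h3⟩, ⟨h4, h5, h6⟩ | ⟨h4, h5, h6⟩⟩
    · have := mul_left_cancel₀ hm.ne' (h1.symm.trans h4)
      exact absurd (by linarith) hi
    · have h := mul_left_cancel₀ hm.ne' (h1.symm.trans h4)
      have a1 : i' < i := lt_of_le_of_ne (by linarith) hi.symm
      have a2 : j' < j := lt_of_le_of_ne (by linarith) hj.symm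
      have a3 : j' ≤ i := not_lt.1 fun c => hnc2 ⟨a1, c, a2⟩
      have hx : x = i := by linarith
      have hx' : x = j' := by linarith
      exact ⟨x, ⟨Or.inl hx, Or.inr hx'⟩, rfl, by rw [h1, hx]; ring⟩
    · have h := mul_left_cancel₀ hm.ne' (h1.symm.trans h4)
      have a1 : i < i' := lt_of_le_of_ne (by linarith) hi
      have a2 : j < j' := lt_of_le_of_ne (by linarith) hj
      have a3 : j ≤ i' := not_lt.1 fun c => hnc1 ⟨a1, c, a2⟩
      have hx : x = j := by linarith
      have hx' : x = i' := by linarith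
      exact ⟨x, ⟨Or.inr hx, Or.inl hx'⟩, rfl, by rw [h1, hx]; ring⟩
    · have := mul_left_cancel₀ hm.ne' (h1.symm.trans h4)
      exact absurd (by linarith) hj
  · rintro ⟨q, ⟨hq, hq'⟩, rfl, rfl⟩
    constructor
    · rcases hq with rfl | rfl
      · exact Or.inl ⟨by ring, le_rfl, by linarith⟩
      · exact Or.inr ⟨by ring, by linarith, le_rfl⟩
    · rcases hq' with rfl | rfl
      · exact Or.inl ⟨by ring, le_rfl, by linarith⟩
      · exact Or.inr ⟨by ring, by linarith, le_rfl⟩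
end

section
/- Let m > 0 be a real number and let A be a set of pairs (i,j) of real numbers with i < j such that any two distinct pairs in A have distinct first coordinates and distinct second coordinates. Then no point of ℝ² lies on the triangular arc paths Δ_m(a) for three pairwise distinct elements a of A. -/
/-- A point on the path determines the initial point or the terminal point of the arc. -/
theorem triPath_endpoint (m i j : ℝ) (hm : 0 < m) (p : ℝ × ℝ) (h : p ∈ triPath m i j) :
    i = p.1 - p.2 / m ∨ j = p.1 + p.2 / m := by
  rcases h with h | h
  · left
    obtain ⟨u, v, _, _, huv, rfl⟩ := h
    obtain rfl : u = 1 - v := by linarith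
    simp [apexPt]
    field_simp
    ring
  · right
    obtain ⟨u, v, _, _, huv, rfl⟩ := h
    obtain rfl : u = 1 - v := by linarith
    simp [apexPt]
    field_simp
    ring

/-- If `A` is a set of arcs `(i,j)` with `i < j`, any two distinct members having distinct
first coordinates and distinct second coordinates, then no point of `ℝ²` lies on the
triangular arc paths `Δ_m(a)` of three pairwise distinct elements `a` of `A`. -/
theorem stmt12 (m : ℝ) (hm : 0 < m) (A : Set (ℝ × ℝ))
    (hlt : ∀ a ∈ A, a.1 < a.2)
    (hfst : ∀ a ∈ A, ∀ b ∈ A, a ≠ b → a.1 ≠ b.1)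
    (hsnd : ∀ a ∈ A, ∀ b ∈ A, a ≠ b → a.2 ≠ b.2) :
    ¬ ∃ (p : ℝ × ℝ) (a b c : ℝ × ℝ), a ∈ A ∧ b ∈ A ∧ c ∈ A ∧
      a ≠ b ∧ a ≠ c ∧ b ≠ c ∧
      p ∈ triPath m a.1 a.2 ∧ p ∈ triPath m b.1 b.2 ∧ p ∈ triPath m c.1 c.2 := by
  rintro ⟨p, a, b, c, ha, hb, hc, hab, hac, hbc, pa, pb, pc⟩
  have a1 := hfst a ha b hb hab
  have a2 := hfst a ha c hc hac
  have a3 := hfst b hb c hc hbc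
  have b1 := hsnd a ha b hb hab
  have b2 := hsnd a ha c hc hac
  have b3 := hsnd b hb c hc hbc
  rcases triPath_endpoint m _ _ hm p pa with h1 | h1 <;>
  rcases triPath_endpoint m _ _ hm p pb with h2 | h2 <;>
  rcases triPath_endpoint m _ _ hm p pc with h3 | h3 <;>
  first
  | exact a1 (h1.trans h2.symm)
  | exact a2 (h1.trans h3.symm)
  | exact a3 (h2.trans h3.symm)
  | exact b1 (h1.trans h2.symm)
  | exact b2 (h1.trans h3.symm)
  | exact b3 (h2.trans h3.symm)
end
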